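/- Let T > 0, b > 1, and c ∈ [1/b, 1], and let ω : [0, bT] → ℝ be continuous. Then sup_{s∈[0,T]} min(|√c · ω(s/c) − ω(s)|, 1) ≤ |1 − √c| · sup_{u∈[0,bT]} |ω(u)| + sup{ min(|ω(u) − ω(v)|, 1) : u, v ∈ [0, bT], |u − v| ≤ T(b − 1) }. -/

import Mathlib

open Set

/-- deterministic rescaling inequality: for `T > 0`, `b > 1`, `c ∈ [1/b, 1]` and
`ω` continuous on `[0, bT]`,
`sup_{s ∈ [0,T]} min(|√c ω(s/c) - ω(s)|, 1)
  ≤ |1 - √c| sup_{u ∈ [0,bT]} |ω u| + sup{ min(|ω u - ω v|,1) : u,v ∈ [0,bT], |u-v| ≤ T(b-1) }`. -/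
theorem stmt9 (T b c : ℝ) (hT : 0 < T) (hb : 1 < b) (hc : c ∈ Icc (1 / b) 1)
    (ω : ℝ → ℝ) (hω : ContinuousOn ω (Icc 0 (b * T))) :
    (⨆ s : Icc (0 : ℝ) T, min |Real.sqrt c * ω ((s : ℝ) / c) - ω s| 1) ≤
      |1 - Real.sqrt c| * (⨆ u : Icc (0 : ℝ) (b * T), |ω u|) +
        sSup {x : ℝ | ∃ u ∈ Icc (0 : ℝ) (b * T), ∃ v ∈ Icc (0 : ℝ) (b * T),
          |u - v| ≤ T * (b - 1) ∧ x = min |ω u - ω v| 1} := by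
  obtain ⟨hc1, hc2⟩ := hc
  have hb0 : 0 < b := by linarith
  have hc0 : 0 < c := lt_of_lt_of_le (by positivity) hc1
  have : Nonempty (Icc (0 : ℝ) T) := ⟨⟨0, le_refl _, hT.le⟩⟩
  apply ciSup_le
  rintro ⟨s, hs0, hsT⟩
  have hbc : 1 ≤ b * c := by
    rw [div_le_iff₀ hb0] at hc1
    linarith
  have h1 : s / c ≤ b * s := by
    rw [div_le_iff₀ hc0]
    nlinarith
  have h2 : s ≤ s / c := by
    rw [le_div_iff₀ hc0]
    nlinarith
  have h3 : b * s ≤ b * T := mul_le_mul_of_nonneg_left hsT hb0.le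
  have hu : s / c ∈ Icc (0 : ℝ) (b * T) := ⟨by positivity, by linarith⟩
  have hv : s ∈ Icc (0 : ℝ) (b * T) := ⟨hs0, by linarith⟩
  have hd : |s / c - s| ≤ T * (b - 1) := by
    rw [abs_of_nonneg (by linarith)]
    nlinarith
  have hbdd : BddAbove (range fun u : Icc (0 : ℝ) (b * T) => |ω u|) := by
    obtain ⟨C, hC⟩ := isCompact_Icc.exists_bound_of_continuousOn hω
    refine ⟨C, ?_⟩
    rintro _ ⟨u, rfl⟩
    exact hC u u.2
  have e1 : |ω (s / c)| ≤ ⨆ u : Icc (0 : ℝ) (b * T), |ω u| :=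
    le_ciSup hbdd ⟨s / c, hu⟩
  have e2 : min |ω (s / c) - ω s| 1 ≤
      sSup {x : ℝ | ∃ u ∈ Icc (0 : ℝ) (b * T), ∃ v ∈ Icc (0 : ℝ) (b * T),
          |u - v| ≤ T * (b - 1) ∧ x = min |ω u - ω v| 1} := by
    apply le_csSup
    · refine ⟨1, ?_⟩
      rintro _ ⟨u, _, v, _, _, rfl⟩
      exact min_le_right _ _
    · exact ⟨_, hu, _, hv, hd, rfl⟩
  refine le_trans ?_ (add_le_add (mul_le_mul_of_nonneg_left e1 (abs_nonneg _)) e2)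
  have e3 : |Real.sqrt c * ω (s / c) - ω s| ≤
      |1 - Real.sqrt c| * |ω (s / c)| + |ω (s / c) - ω s| := by
    rw [abs_sub_comm (1 : ℝ), ← abs_mul]
    refine le_trans (le_of_eq ?_) (abs_add_le _ _)
    congr 1
    ring
  have e4 : 0 ≤ |1 - Real.sqrt c| * |ω (s / c)| := by positivity
  show min |Real.sqrt c * ω (s / c) - ω s| 1 ≤ _
  rcases le_total |ω (s / c) - ω s| 1 with h | h
  · rw [min_eq_left h]
    exact (min_le_left _ _).trans e3
  · rw [min_eq_right h]
    exact (min_le_right _ _).trans (by linarith)
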